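/- arXiv:2407.06338 — 2 statements merged into one kernel-verified Lean document; each statement's English description precedes it below -/
import Mathlib

section
/- For all n ≥ 1, all k ≥ 2, and each pattern σ ∈ {231, 312, 321}, the number of permutations π ∈ S_n such that π, θ(π), θ²(π), …, θ^k(π) all avoid σ is t_n^k(σ) = F_{n+1}. -/
/-- The one-line word of the image of `π` under the fundamental bijection:
write `π` in standard cycle form (every cycle written with its largest element
first, cycles listed in increasing order of their largest elements) and erase
the parentheses.  The cycle maxima are exactly the `x` with `π^[k] x ≤ x` for
all `k`, and the cycle of `x` is `x, π x, π² x, …` up to the period of `x`. -/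
noncomputable def fundWord {n : ℕ} (π : Equiv.Perm (Fin n)) : List (Fin n) :=
  ((List.finRange n).filter fun x => (List.range n).all fun k => decide ((⇑π)^[k] x ≤ x)).flatMap
    fun x => (List.range (Function.minimalPeriod (⇑π) x)).map fun k => (⇑π)^[k] x

/-- The permutation whose one-line notation is the word `w`
(junk value if `w` is not the one-line notation of a permutation). -/
noncomputable def permOfWord {n : ℕ} (w : List (Fin n)) : Equiv.Perm (Fin n) :=
  Function.invFun (fun σ : Equiv.Perm (Fin n) => (List.finRange n).map ⇑σ) w

/-- The fundamental bijection `θ`. -/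
noncomputable def theta {n : ℕ} (π : Equiv.Perm (Fin n)) : Equiv.Perm (Fin n) :=
  permOfWord (fundWord π)

/-- `π` contains the pattern `σ`. -/
def Contains {k n : ℕ} (σ : Equiv.Perm (Fin k)) (π : Equiv.Perm (Fin n)) : Prop :=
  ∃ f : Fin k → Fin n, StrictMono f ∧ ∀ a b : Fin k, π (f a) < π (f b) ↔ σ a < σ b

/-- `π` avoids the pattern `σ`. -/
def Avoids {k n : ℕ} (π : Equiv.Perm (Fin n)) (σ : Equiv.Perm (Fin k)) : Prop :=
  ¬ Contains σ π

noncomputable def p123 : Equiv.Perm (Fin 3) := Equiv.ofBijective ![0, 1, 2] (by decide)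
noncomputable def p132 : Equiv.Perm (Fin 3) := Equiv.ofBijective ![0, 2, 1] (by decide)
noncomputable def p213 : Equiv.Perm (Fin 3) := Equiv.ofBijective ![1, 0, 2] (by decide)
noncomputable def p231 : Equiv.Perm (Fin 3) := Equiv.ofBijective ![1, 2, 0] (by decide)
noncomputable def p312 : Equiv.Perm (Fin 3) := Equiv.ofBijective ![2, 0, 1] (by decide)
noncomputable def p321 : Equiv.Perm (Fin 3) := Equiv.ofBijective ![2, 1, 0] (by decide)

/-- The direct sum `π ⊕ τ` of two permutations. -/
def directSum {n m : ℕ} (π : Equiv.Perm (Fin n)) (τ : Equiv.Perm (Fin m)) :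
    Equiv.Perm (Fin (n + m)) :=
  finSumFinEquiv.permCongr (Equiv.sumCongr π τ)

/-- A permutation is irreducible if it is not a direct sum of two nonempty permutations. -/
def IrreduciblePerm {n : ℕ} (π : Equiv.Perm (Fin n)) : Prop :=
  ¬ ∃ (a b : ℕ) (_ : 0 < a) (_ : 0 < b) (h : a + b = n)
      (σ : Equiv.Perm (Fin a)) (τ : Equiv.Perm (Fin b)),
      π = (finCongr h).permCongr (directSum σ τ)

/-- A permutation is cyclic if its cycle decomposition is a single cycle of full length,
i.e. it acts transitively. -/
def IsCyclicPerm {n : ℕ} (π : Equiv.Perm (Fin n)) : Prop :=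
  ∀ x y : Fin n, ∃ k : ℕ, (⇑π)^[k] x = y

open Function

section CycleForm

variable {n : ℕ} (π : Equiv.Perm (Fin n))

/-- `c` is the largest element of its cycle. -/
def IsCycleTop (c : Fin n) : Prop := ∀ k, (⇑π)^[k] c ≤ c

theorem minimalPeriod_perm_pos (u : Fin n) : 0 < minimalPeriod π u :=
  minimalPeriod_pos_of_mem_periodicPts (π.injective.mem_periodicPts u)

theorem exists_iterate_iterate_eq (u : Fin n) (k : ℕ) : ∃ m, (⇑π)^[m] ((⇑π)^[k] u) = u := by
  have hN := minimalPeriod_perm_pos π u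
  refine ⟨minimalPeriod π u * k - k, ?_⟩
  rw [← iterate_add_apply, Nat.sub_add_cancel (Nat.le_mul_of_pos_left k hN)]
  exact (isPeriodicPt_minimalPeriod π u).mul_const k

theorem exists_cycleTop (u : Fin n) :
    ∃ p : Fin n × ℕ, IsCycleTop π p.1 ∧ p.2 < minimalPeriod π p.1 ∧ (⇑π)^[p.2] p.1 = u := by
  obtain ⟨c, ⟨k, rfl⟩, hk⟩ := Set.exists_max_image (Set.range fun k => (⇑π)^[k] u) id
    (Set.toFinite _) ⟨u, 0, rfl⟩
  obtain ⟨m, hm⟩ := exists_iterate_iterate_eq π u k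
  refine ⟨((⇑π)^[k] u, m % minimalPeriod π ((⇑π)^[k] u)), fun j => ?_,
    Nat.mod_lt _ (minimalPeriod_perm_pos π _), ?_⟩
  · have := hk _ ⟨j + k, rfl⟩
    simpa [iterate_add_apply] using this
  · simpa [iterate_mod_minimalPeriod_eq] using hm

/-- The largest element of the cycle of `u`. -/
noncomputable def cycleTop (u : Fin n) : Fin n := (exists_cycleTop π u).choose.1

/-- The position of `u` in its cycle, counted from the largest element. -/
noncomputable def cycleIdx (u : Fin n) : ℕ := (exists_cycleTop π u).choose.2

theorem isCycleTop_cycleTop (u : Fin n) : IsCycleTop π (cycleTop π u) :=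
  (exists_cycleTop π u).choose_spec.1

theorem cycleIdx_lt (u : Fin n) : cycleIdx π u < minimalPeriod π (cycleTop π u) :=
  (exists_cycleTop π u).choose_spec.2.1

theorem iterate_cycleIdx (u : Fin n) : (⇑π)^[cycleIdx π u] (cycleTop π u) = u :=
  (exists_cycleTop π u).choose_spec.2.2

variable {π}

theorem IsCycleTop.cycleTop_iterate {c : Fin n} (hc : IsCycleTop π c) (i : ℕ) :
    cycleTop π ((⇑π)^[i] c) = c := by
  have h := iterate_cycleIdx π ((⇑π)^[i] c)
  have ht := isCycleTop_cycleTop π ((⇑π)^[i] c)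
  generalize cycleTop π ((⇑π)^[i] c) = t at *
  generalize cycleIdx π ((⇑π)^[i] c) = j at *
  apply le_antisymm
  · obtain ⟨m, hm⟩ := exists_iterate_iterate_eq π t j
    rw [h, ← iterate_add_apply] at hm
    exact hm ▸ hc _
  · obtain ⟨m, hm⟩ := exists_iterate_iterate_eq π c i
    rw [← h, ← iterate_add_apply] at hm
    exact hm ▸ ht _

theorem IsCycleTop.cycleIdx_iterate {c : Fin n} (hc : IsCycleTop π c) {i : ℕ}
    (hi : i < minimalPeriod π c) : cycleIdx π ((⇑π)^[i] c) = i := by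
  have h := iterate_cycleIdx π ((⇑π)^[i] c)
  have hl := cycleIdx_lt π ((⇑π)^[i] c)
  rw [hc.cycleTop_iterate] at h hl
  exact (iterate_eq_iterate_iff_of_lt_minimalPeriod hl hi).1 h

theorem IsCycleTop.cycleTop_eq {c : Fin n} (hc : IsCycleTop π c) : cycleTop π c = c :=
  hc.cycleTop_iterate 0

theorem IsCycleTop.cycleIdx_eq {c : Fin n} (hc : IsCycleTop π c) : cycleIdx π c = 0 :=
  hc.cycleIdx_iterate (minimalPeriod_perm_pos π c)

@[simp] theorem cycleTop_apply (u : Fin n) : cycleTop π (π u) = cycleTop π u := by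
  conv_lhs => rw [← iterate_cycleIdx π u, ← iterate_succ_apply' (f := π)]
  exact (isCycleTop_cycleTop π u).cycleTop_iterate _

@[simp] theorem cycleTop_symm_apply (u : Fin n) : cycleTop π (π.symm u) = cycleTop π u := by
  simpa using (cycleTop_apply (π := π) (π.symm u)).symm

theorem le_cycleTop (u : Fin n) : u ≤ cycleTop π u := by
  simpa [iterate_cycleIdx] using isCycleTop_cycleTop π u (cycleIdx π u)

theorem apply_le_cycleTop (u : Fin n) : π u ≤ cycleTop π u := by
  simpa using le_cycleTop (π := π) (π u)

theorem cycleIdx_eq_zero {u : Fin n} (h : cycleIdx π u = 0) : u = cycleTop π u := by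
  simpa [h] using (iterate_cycleIdx π u).symm

theorem exists_iterate_eq_cycleTop (u : Fin n) : ∃ k, (⇑π)^[k] u = cycleTop π u := by
  obtain ⟨m, hm⟩ := exists_iterate_iterate_eq π (cycleTop π u) (cycleIdx π u)
  exact ⟨m, by rwa [iterate_cycleIdx] at hm⟩

/-- A set of points stable under `π` that meets a cycle contains its largest element. -/
theorem cycleTop_induction {P : Fin n → Prop} {u : Fin n} (h0 : P u)
    (h : ∀ v, cycleTop π v = cycleTop π u → P v → P (π v)) : P (cycleTop π u) := by
  obtain ⟨k, hk⟩ := exists_iterate_eq_cycleTop (π := π) u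
  suffices ∀ j, cycleTop π ((⇑π)^[j] u) = cycleTop π u ∧ P ((⇑π)^[j] u) from hk ▸ (this k).2
  intro j
  induction j with
  | zero => exact ⟨rfl, h0⟩
  | succ j ih =>
    rw [iterate_succ_apply']
    exact ⟨by simp [ih.1], h _ ih.1 ih.2⟩

/-- A set of points stable under `π` that contains the largest element of a cycle contains the
whole cycle. -/
theorem cycle_induction {P : Fin n → Prop} {u : Fin n} (h0 : P (cycleTop π u))
    (h : ∀ v, cycleTop π v = cycleTop π u → P v → P (π v)) : P u := by
  have ht := isCycleTop_cycleTop π u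
  suffices ∀ j, P ((⇑π)^[j] (cycleTop π u)) by simpa [iterate_cycleIdx] using this (cycleIdx π u)
  intro j
  induction j with
  | zero => exact h0
  | succ j ih =>
    rw [iterate_succ_apply']
    exact h _ (ht.cycleTop_iterate j) ih

variable (π)

/-- `u` is written before `v` in the standard cycle form of `π`. -/
def Before (u v : Fin n) : Prop :=
  cycleTop π u < cycleTop π v ∨ cycleTop π u = cycleTop π v ∧ cycleIdx π u < cycleIdx π v

theorem Before.trans {u v w : Fin n} (h : Before π u v) (h' : Before π v w) : Before π u w := by
  unfold Before at *
  omega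

theorem Before.irrefl (u : Fin n) : ¬ Before π u u := by
  unfold Before
  omega

theorem pairwise_fundWord : (fundWord π).Pairwise (Before π) := by
  have key : ∀ c : Fin n, ((List.range n).all fun k => decide ((⇑π)^[k] c ≤ c)) = true →
      IsCycleTop π c := by
    intro c hc k
    simp only [List.all_eq_true, List.mem_range, decide_eq_true_eq] at hc
    rw [← iterate_mod_minimalPeriod_eq]
    refine hc _ ((Nat.mod_lt _ (minimalPeriod_perm_pos π c)).trans_le ?_)
    simpa using minimalPeriod_le_card (f := π) (x := c)
  rw [fundWord, List.pairwise_flatMap]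
  constructor
  · intro c hc
    have hc := key c (List.mem_filter.1 hc).2
    rw [List.pairwise_map]
    refine (List.pairwise_lt_range).imp_of_mem fun {i j} hi hj hij => .inr ?_
    rw [List.mem_range] at hi hj
    rw [hc.cycleTop_iterate, hc.cycleTop_iterate, hc.cycleIdx_iterate hi, hc.cycleIdx_iterate hj]
    exact ⟨rfl, hij⟩
  · refine ((List.pairwise_lt_finRange n).filter _).imp_of_mem ?_
    intro c d hc hd hcd u hu v hv
    have hc := key c (List.mem_filter.1 hc).2
    have hd := key d (List.mem_filter.1 hd).2
    simp only [List.mem_map] at hu hv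
    obtain ⟨i, -, rfl⟩ := hu
    obtain ⟨j, -, rfl⟩ := hv
    exact .inl (by rwa [hc.cycleTop_iterate, hd.cycleTop_iterate])

theorem mem_fundWord (u : Fin n) : u ∈ fundWord π := by
  rw [fundWord, List.mem_flatMap]
  refine ⟨cycleTop π u, ?_, List.mem_map.2 ⟨cycleIdx π u, List.mem_range.2 (cycleIdx_lt π u),
    iterate_cycleIdx π u⟩⟩
  simpa using fun k _ => isCycleTop_cycleTop π u k

theorem map_theta_finRange : (List.finRange n).map (theta π) = fundWord π := by
  refine Function.invFun_eq (f := fun σ : Equiv.Perm (Fin n) => (List.finRange n).map ⇑σ) ?_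
  have hnd : (fundWord π).Nodup := List.nodup_iff_pairwise_ne.2 <|
    (pairwise_fundWord π).imp (S := (· ≠ ·)) fun {a b} h e =>
      Before.irrefl π b (by rwa [e] at h)
  let e := hnd.getEquivOfForallMemList _ (mem_fundWord π)
  have hlen : (fundWord π).length = n := by simpa using Fintype.card_congr e
  refine ⟨(finCongr hlen.symm).trans e, ?_⟩
  apply List.ext_getElem
  · simp [hlen]
  · intro i h1 h2
    simp [e]

theorem before_theta {p q : Fin n} (h : p < q) : Before π (theta π p) (theta π q) := by
  have := pairwise_fundWord π
  rw [← map_theta_finRange, List.pairwise_map, List.pairwise_iff_getElem] at this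
  simpa using this p q (by simp) (by simp) h

variable {π}

theorem symm_theta_lt_iff {u v : Fin n} :
    (theta π).symm u < (theta π).symm v ↔ Before π u v := by
  constructor
  · intro h
    simpa using before_theta π h
  · intro h
    by_contra hn
    rcases (not_lt.1 hn).eq_or_lt with h' | h'
    · exact Before.irrefl π u ((theta π).symm.injective h' ▸ h)
    · exact Before.irrefl π u (h.trans π (by simpa using before_theta π h'))

theorem theta_eq_of_before {τ : Equiv.Perm (Fin n)}
    (h : ∀ p q, p < q → Before π (τ p) (τ q)) : theta π = τ := by
  have hm : StrictMono (τ.trans (theta π).symm) := fun p q hpq => by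
    simpa [symm_theta_lt_iff] using h p q hpq
  ext p
  have := congrArg (fun f : Fin n ≃o Fin n => theta π (f p))
    (Subsingleton.elim (hm.orderIsoOfSurjective _ (Equiv.surjective _)) (OrderIso.refl _))
  simpa using congrArg Fin.val this.symm

end CycleForm

section Stable

variable {n : ℕ} {π : Equiv.Perm (Fin n)} {m : ℕ}

/-- `π` maps the `m` smallest points to themselves. -/
def StableBelow (π : Equiv.Perm (Fin n)) (m : ℕ) : Prop := ∀ u : Fin n, u.val < m → (π u).val < m

theorem StableBelow.symm (h : StableBelow π m) : StableBelow π.symm m := by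
  intro u hu
  have hinj : Set.InjOn π {v | v.val < m} := π.injective.injOn
  obtain ⟨v, hv, rfl⟩ := (((Set.toFinite {v : Fin n | v.val < m}).injOn_iff_bijOn_of_mapsTo
    h).1 hinj).surjOn hu
  simpa using hv

theorem StableBelow.apply_lt_iff (h : StableBelow π m) (u : Fin n) :
    (π u).val < m ↔ u.val < m :=
  ⟨fun hu => by simpa using h.symm _ hu, h u⟩

theorem StableBelow.symm_apply_lt_iff (h : StableBelow π m) (u : Fin n) :
    (π.symm u).val < m ↔ u.val < m := h.symm.apply_lt_iff u

theorem StableBelow.cycleTop_lt_iff (h : StableBelow π m) (u : Fin n) :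
    (cycleTop π u).val < m ↔ u.val < m := by
  constructor
  · exact fun hu => (Fin.le_def.1 (le_cycleTop u)).trans_lt hu
  · exact fun hu => cycleTop_induction (P := fun v => v.val < m) hu fun v _ hv => h v hv

/-- If each of the `m` smallest points is sent below every other point, then the `m` smallest
points are stable. -/
theorem stableBelow_of_lt (h : ∀ u v : Fin n, u.val < m → m ≤ v.val → π u < π v) :
    StableBelow π m := by
  intro u hu
  by_contra! hn
  have hsub : (Finset.univ.filter fun v : Fin n => m ≤ v.val).image π ⊆
      (Finset.univ.filter fun v : Fin n => m ≤ v.val).erase (π u) := by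
    intro v hv
    simp only [Finset.mem_image, Finset.mem_filter, Finset.mem_univ, true_and] at hv
    obtain ⟨v, hv, rfl⟩ := hv
    have := h u v hu hv
    simp only [Finset.mem_erase, Finset.mem_filter, Finset.mem_univ, true_and]
    exact ⟨this.ne', by omega⟩
  have hc := Finset.card_le_card hsub
  rw [Finset.card_image_of_injective _ π.injective] at hc
  exact (Finset.card_erase_lt_of_mem (by simpa using hn)).not_ge hc

theorem StableBelow.theta (h : StableBelow π m) : StableBelow (theta π) m := by
  refine StableBelow.symm (π := (_root_.theta π).symm) (stableBelow_of_lt fun u v hu hv => ?_)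
  rw [symm_theta_lt_iff]
  have h1 := h.cycleTop_lt_iff u
  have h2 := h.cycleTop_lt_iff v
  left
  omega

/-- If `0, …, x` are stable under `π`, then the last letter of `θ(π)` among them closes the cycle
of `x`. -/
theorem StableBelow.theta_apply {x : Fin n} (h : StableBelow π (x.val + 1)) :
    _root_.theta π x = π.symm x := by
  have hx : cycleTop π x = x := le_antisymm
    (by have := h.cycleTop_lt_iff x; rw [Fin.le_def]; omega) (le_cycleTop x)
  have hlast : ∀ u : Fin n, u ≤ x → ¬ Before π (π.symm x) u := by
    intro u hu hb
    have h1 := h.cycleTop_lt_iff u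
    rcases hb with hb | ⟨hb, hb'⟩
    · rw [cycleTop_symm_apply, hx] at hb
      omega
    · rw [cycleTop_symm_apply, hx] at hb
      have hlt := cycleIdx_lt π u
      have hc : IsCycleTop π x := hx ▸ isCycleTop_cycleTop π x
      rw [← hb] at hlt
      have := hc.cycleTop_iterate (cycleIdx π (π.symm x) + 1)
      have h0 := hc.cycleIdx_iterate (i := cycleIdx π (π.symm x) + 1) (by omega)
      have h3 : (⇑π)^[cycleIdx π (π.symm x) + 1] x = x := by
        have := iterate_cycleIdx π (π.symm x)
        rw [cycleTop_symm_apply, hx] at this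
        rw [iterate_succ_apply', this, Equiv.apply_symm_apply]
      rw [h3, hc.cycleIdx_eq] at h0
      omega
  have hw := h.theta
  have h1 := hw.apply_lt_iff x
  have h2 := hw.symm_apply_lt_iff (π.symm x)
  have h3 := h.symm_apply_lt_iff x
  have h4 := hlast (_root_.theta π x) (by rw [Fin.le_def]; omega)
  rw [← symm_theta_lt_iff, Equiv.symm_apply_apply] at h4
  rw [← Equiv.eq_symm_apply]
  rw [Fin.ext_iff]
  omega

end Stable

section Near

variable {n : ℕ} {π : Equiv.Perm (Fin n)}

/-- `π` is a product of disjoint adjacent transpositions. -/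
def IsNear (π : Equiv.Perm (Fin n)) : Prop :=
  (∀ u, π (π u) = u) ∧ ∀ u, (π u).val ≤ u.val + 1

theorem isNear_of_cycleTop_le
    (h : ∀ a : Fin n, StableBelow π a.val → (cycleTop π a).val ≤ a.val + 1) : IsNear π := by
  have step : ∀ a : Fin n, StableBelow π a.val → π a = a ∨
      (π a).val = a.val + 1 ∧ π (π a) = a := by
    intro a ha
    have h1 := h a ha
    have h2 := ha.apply_lt_iff a
    have h3 := Fin.le_def.1 (apply_le_cycleTop (π := π) a)
    by_cases hfix : π a = a
    · exact .inl hfix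
    have h4 : (π a).val ≠ a.val := fun e => hfix (Fin.ext e)
    refine .inr ⟨by omega, ?_⟩
    have h5 := ha.apply_lt_iff (π a)
    have h6 := Fin.le_def.1 (apply_le_cycleTop (π := π) (π a))
    rw [cycleTop_apply] at h6
    have h7 : (π (π a)).val ≠ (π a).val := fun e => hfix (π.injective (Fin.ext e))
    exact Fin.ext (by omega)
  let Q : ℕ → Prop := fun m => StableBelow π m ∧
    ∀ u : Fin n, u.val < m → π (π u) = u ∧ (π u).val ≤ u.val + 1
  have hQ : ∀ m ≤ n, Q m ∨ Q (m + 1) := by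
    intro m
    induction m with
    | zero => exact fun _ => .inl ⟨fun u hu => by omega, fun u hu => by omega⟩
    | succ m ih =>
      intro hm
      rcases ih (by omega) with ⟨hs, hq⟩ | hq
      · let a : Fin n := ⟨m, by omega⟩
        rcases step a hs with ha | ⟨ha, hb⟩
        · left
          refine ⟨fun u hu => ?_, fun u hu => ?_⟩
          · rcases Nat.lt_succ_iff_lt_or_eq.1 hu with hu | hu
            · exact (hs u hu).trans (Nat.lt_succ_self m)
            · obtain rfl : u = a := Fin.ext hu
              rw [ha]; exact Nat.lt_succ_self m
          · rcases Nat.lt_succ_iff_lt_or_eq.1 hu with hu | hu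
            · exact hq u hu
            · obtain rfl : u = a := Fin.ext hu
              simp [ha]
        · right
          have hc : ∀ u : Fin n, u.val < m + 1 + 1 → u.val < m ∨ u = a ∨ u = π a := by
            intro u hu
            simp only [Fin.ext_iff, ha]
            change _ ∨ u.val = m ∨ u.val = m + 1
            omega
          refine ⟨fun u hu => ?_, fun u hu => ?_⟩
          · rcases hc u hu with hu | rfl | rfl
            · exact (hs u hu).trans (by omega)
            · rw [ha]; change m + 1 < _; omega
            · rw [hb]; change m < _; omega
          · rcases hc u hu with hu | rfl | rfl
            · exact hq u hu
            · exact ⟨hb, ha.le⟩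
            · exact ⟨by rw [hb], by rw [hb]; omega⟩
      · exact .inl hq
  rcases hQ n le_rfl with ⟨-, hq⟩ | ⟨-, hq⟩
  · exact ⟨fun u => (hq u u.2).1, fun u => (hq u u.2).2⟩
  · exact ⟨fun u => (hq u (by omega)).1, fun u => (hq u (by omega)).2⟩

theorem IsNear.theta_eq (h : IsNear π) : theta π = π := by
  have htop : ∀ u, (cycleTop π u).val = max u.val (π u).val := by
    intro u
    have h1 := Fin.le_def.1 (le_cycleTop (π := π) u)
    have h2 := Fin.le_def.1 (apply_le_cycleTop (π := π) u)
    have h3 : cycleTop π u = u ∨ cycleTop π u = π u :=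
      cycleTop_induction (P := fun v => v = u ∨ v = π u) (.inl rfl) fun v _ hv => by
        rcases hv with rfl | rfl
        · exact .inr rfl
        · exact .inl (h.1 u)
    rcases h3 with h3 | h3 <;> rw [h3] at h1 h2 ⊢ <;> omega
  refine theta_eq_of_before fun p q hpq => ?_
  unfold Before
  have hp := htop p
  have hq := htop q
  have h1 := h.2 p
  rw [cycleTop_apply, cycleTop_apply]
  rcases lt_or_ge (cycleTop π p) (cycleTop π q) with hlt | hge
  · exact .inl hlt
  right
  have hq1 : q.val = p.val + 1 := by omega
  have hpq' : π p = q := Fin.ext (by omega)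
  have hqp : π q = p := by rw [← hpq', h.1]
  have htq : cycleTop π q = q := by
    rw [Fin.ext_iff, hq, hqp]; omega
  have hc : IsCycleTop π q := htq ▸ isCycleTop_cycleTop π q
  refine ⟨Fin.ext (by omega), ?_⟩
  rw [hpq', hc.cycleIdx_eq]
  refine Nat.pos_of_ne_zero fun h0 => ?_
  have := cycleIdx_eq_zero h0
  rw [cycleTop_apply, htq] at this
  rw [this] at hqp
  exact hpq.ne hqp.symm

/-- Every entry of a near permutation is displaced by at most one. -/
theorem IsNear.le_apply_add_one (h : IsNear π) (u : Fin n) : u.val ≤ (π u).val + 1 := by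
  simpa [h.1 u] using h.2 (π u)

theorem avoids_of_forall {σ : Equiv.Perm (Fin 3)}
    (h : ∀ i j k : Fin n, i < j → j < k → (π i < π j ↔ σ 0 < σ 1) → (π j < π k ↔ σ 1 < σ 2) →
      (π i < π k ↔ σ 0 < σ 2) → False) : Avoids π σ := by
  rintro ⟨f, hf, hfσ⟩
  exact h _ _ _ (hf (by decide : (0 : Fin 3) < 1)) (hf (by decide : (1 : Fin 3) < 2))
    (hfσ 0 1) (hfσ 1 2) (hfσ 0 2)

theorem contains_of_lt {σ : Equiv.Perm (Fin 3)} {i j k : Fin n} (hij : i < j) (hjk : j < k)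
    (h01 : π i < π j ↔ σ 0 < σ 1) (h12 : π j < π k ↔ σ 1 < σ 2) (h02 : π i < π k ↔ σ 0 < σ 2) :
    Contains σ π := by
  have key : ∀ {a b : Fin n} {c d : Fin 3}, a ≠ b → c ≠ d → (π a < π b ↔ σ c < σ d) →
      (π b < π a ↔ σ d < σ c) := by
    intro a b c d hab hcd h
    have h1 := π.injective.ne hab
    have h2 := σ.injective.ne hcd
    omega
  refine ⟨![i, j, k], ?_, ?_⟩
  · rw [Fin.strictMono_iff_lt_succ]
    intro a
    fin_cases a <;> simpa
  · intro a b
    fin_cases a <;> fin_cases b <;> simp <;>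
      first
        | assumption
        | exact key (by omega) (by decide) ‹_›

@[simp] theorem p231_apply : p231 0 = 1 ∧ p231 1 = 2 ∧ p231 2 = 0 := ⟨rfl, rfl, rfl⟩
@[simp] theorem p312_apply : p312 0 = 2 ∧ p312 1 = 0 ∧ p312 2 = 1 := ⟨rfl, rfl, rfl⟩
@[simp] theorem p321_apply : p321 0 = 2 ∧ p321 1 = 1 ∧ p321 2 = 0 := ⟨rfl, rfl, rfl⟩

theorem IsNear.avoids (h : IsNear π) {σ : Equiv.Perm (Fin 3)}
    (hσ : σ = p231 ∨ σ = p312 ∨ σ = p321) : Avoids π σ := by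
  refine avoids_of_forall fun i j k hij hjk h01 h12 h02 => ?_
  have hi := h.2 i
  have hne := π.injective.ne (hij.trans hjk).ne
  have hne' := π.injective.ne hjk.ne
  have hj := h.le_apply_add_one j
  have hk := h.le_apply_add_one k
  rcases hσ with rfl | rfl | rfl <;> simp at h01 h12 h02 <;> omega

theorem Avoids.not_231 (h : Avoids π p231) {i j k : Fin n} (hij : i < j) (hjk : j < k)
    (h1 : π k < π i) (h2 : π i < π j) : False :=
  h (contains_of_lt hij hjk (by simp [h2]) (by simp; omega) (by simp; omega))

theorem Avoids.not_312 (h : Avoids π p312) {i j k : Fin n} (hij : i < j) (hjk : j < k)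
    (h1 : π j < π k) (h2 : π k < π i) : False :=
  h (contains_of_lt hij hjk (by simp; omega) (by simp; omega) (by simp; omega))

theorem Avoids.not_321 (h : Avoids π p321) {i j k : Fin n} (hij : i < j) (hjk : j < k)
    (h1 : π k < π j) (h2 : π j < π i) : False :=
  h (contains_of_lt hij hjk (by simp; omega) (by simp; omega) (by simp; omega))

end Near

section Patterns

variable {n : ℕ} {π : Equiv.Perm (Fin n)}

theorem before_of_cycleTop_lt {u v : Fin n} (h : cycleTop π u < cycleTop π v) : Before π u v :=
  .inl h

theorem before_apply_of_ne {c : Fin n} (hc : cycleTop π c = c) (h : π c ≠ c) :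
    Before π c (π c) := by
  have hc' : IsCycleTop π c := hc ▸ isCycleTop_cycleTop π c
  refine .inr ⟨by simp, ?_⟩
  rw [hc'.cycleIdx_eq]
  refine Nat.pos_of_ne_zero fun h0 => h ?_
  simpa [hc] using cycleIdx_eq_zero h0

theorem cycleTop_cycleTop (u : Fin n) : cycleTop π (cycleTop π u) = cycleTop π u :=
  (isCycleTop_cycleTop π u).cycleTop_eq

theorem le_cycleTop_of_cycleTop_eq {u v : Fin n} (h : cycleTop π v = u) : v ≤ u :=
  h ▸ le_cycleTop v

/-- Within a cycle whose second element is `π c`, every element other than `c` and `π c` is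
written after `π c`. -/
theorem before_of_ne_of_ne {c v : Fin n} (hc : cycleTop π c = c) (hv : cycleTop π v = c)
    (h0 : v ≠ c) (h1 : v ≠ π c) : Before π (π c) v := by
  have hc' : IsCycleTop π c := hc ▸ isCycleTop_cycleTop π c
  have hi := iterate_cycleIdx π v
  have hlt := cycleIdx_lt π v
  rw [hv] at hi hlt
  have hi0 : cycleIdx π v ≠ 0 := fun h => h0 (by simpa [h] using hi.symm)
  have hi1 : cycleIdx π v ≠ 1 := fun h => h1 (by simpa [h] using hi.symm)
  refine .inr ⟨by simp [hc, hv], ?_⟩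
  have := hc'.cycleIdx_iterate (i := 1) (by omega)
  rw [iterate_one] at this
  omega

section Pattern312

theorem apply_apply_cycleTop_of_avoids_312 (h0 : Avoids π p312) (h1 : Avoids (theta π) p312)
    {c : Fin n} (hc : cycleTop π c = c) : π (π c) = c := by
  by_contra hne
  have hb : π c ≠ c := fun h => hne (by rw [h, h])
  have hbe : π (π c) ≠ π c := fun h => hb (π.injective h)
  have hlt := le_cycleTop_of_cycleTop_eq (π := π) (v := π c) (by rw [cycleTop_apply, hc])
  have hle := le_cycleTop_of_cycleTop_eq (π := π) (u := c) (v := π (π c)) (by simp [hc])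
  set l := π.symm c with hl
  have hpl : π l = c := by simp [hl]
  have htl : cycleTop π l = c := by simp [hl, hc]
  have hlc : l ≠ c := fun h => hb (by rw [← h, hpl, h])
  have hlb : l ≠ π c := fun h => hne (by rw [← h, hpl])
  have hdesc : ∀ v, cycleTop π v = c → v ≠ c → v ≠ π c → v < π c := by
    intro v hv hvc hvb
    by_contra! hcon
    have hvl := le_cycleTop_of_cycleTop_eq hv
    refine h1.not_312 (symm_theta_lt_iff.2 (before_apply_of_ne hc hb))
      (symm_theta_lt_iff.2 (before_of_ne_of_ne hc hv hvc hvb)) ?_ ?_ <;>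
      simp only [Equiv.apply_symm_apply] <;> omega
  have h2 := hdesc l htl hlc hlb
  have h3 := hdesc (π (π c)) (by simp [hc]) hne hbe
  exact h0.not_312 h2 (lt_of_le_of_ne hlt hb) h3 (by rw [hpl]; exact lt_of_le_of_ne hlt hb)

theorem involutive_of_avoids_312 (h0 : Avoids π p312) (h1 : Avoids (theta π) p312) (u : Fin n) :
    π (π u) = u := by
  refine cycle_induction (P := fun u => π (π u) = u) ?_ fun v _ hv => by rw [hv]
  exact apply_apply_cycleTop_of_avoids_312 h0 h1 (cycleTop_cycleTop u)

theorem isNear_of_avoids_312 (h0 : Avoids π p312) (h1 : Avoids (theta π) p312)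
    (h2 : Avoids (theta (theta π)) p312) : IsNear π := by
  have hi := involutive_of_avoids_312 h0 h1
  have hi' := involutive_of_avoids_312 h1 h2
  refine isNear_of_cycleTop_le fun a ha => ?_
  have hor : ∀ u, cycleTop π u = u ∨ cycleTop π u = π u := fun u =>
    cycleTop_induction (P := fun v => v = u ∨ v = π u) (.inl rfl) fun v _ hv => by
      rcases hv with rfl | rfl
      · exact .inr rfl
      · exact .inl (hi u)
  rcases hor a with hx | hx
  · rw [hx]; omega
  by_contra! hlt
  rw [hx] at hlt
  have hs : StableBelow π ((π a).val + 1) := by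
    intro u hu
    by_contra! hcon
    have hua : u ≠ a := by rintro rfl; omega
    have hux : u ≠ π a := by rintro rfl; rw [hi] at hcon; omega
    have hau := ha.apply_lt_iff u
    refine h0.not_312 (i := u) (j := π a) (k := π u) ?_ ?_ ?_ ?_ <;> (try simp only [hi]) <;> omega
  have hw : theta π (π a) = a := by
    rw [hs.theta_apply, Equiv.symm_apply_apply]
  have hw' : theta π a = π a := by
    rw [← hi' (π a), hw]
  let y : Fin n := ⟨a.val + 1, by omega⟩
  have hy : cycleTop π y < π a := by
    refine lt_of_le_of_ne ?_ fun h => ?_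
    · have := hs.cycleTop_lt_iff y
      change _ ↔ a.val + 1 < _ at this
      rw [Fin.le_def]; omega
    · have hya : y ≠ a := fun h => by simpa [y] using congrArg Fin.val h
      rcases hor y with h' | h'
      · have := congrArg Fin.val (h'.symm.trans h)
        change a.val + 1 = _ at this
        omega
      · exact hya (π.injective (h'.symm.trans h))
  have hb : (theta π).symm y < (theta π).symm (π a) := by
    refine symm_theta_lt_iff.2 (before_of_cycleTop_lt ?_)
    rwa [cycleTop_apply, hx]
  have hpos := ha.theta.symm_apply_lt_iff y
  rw [← hw', Equiv.symm_apply_apply] at hb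
  change _ ↔ a.val + 1 < _ at hpos
  omega

end Pattern312

section Pattern231

theorem apply_eq_cycleTop_of_avoids_231 (h0 : Avoids π p231) {a : Fin n}
    (ha : StableBelow π a.val) : π a = cycleTop π a := by
  set x := cycleTop π a with hx
  set l := π.symm x with hl
  have hpl : π l = x := by simp [hl]
  have hal : ¬ l.val < a.val := by
    have h1 := ha.symm_apply_lt_iff x
    have h2 := Fin.le_def.1 (le_cycleTop (π := π) a)
    omega
  rcases (not_lt.1 hal).eq_or_lt with h | h
  · rw [Fin.ext h, hpl]
  exfalso
  have hlx : l ≤ x := by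
    have := le_cycleTop (π := π) l
    rwa [hl, cycleTop_symm_apply, hx, cycleTop_cycleTop, ← hx, ← hl] at this
  have htop : ∀ v, cycleTop π v = x → v ≠ l → π v < x := fun v hv hvl =>
    lt_of_le_of_ne (hv ▸ apply_le_cycleTop v) fun e => hvl (π.injective (e.trans hpl.symm))
  have hlow : ∀ k, cycleTop π k = x → l < k → l < π k := by
    intro k hk hlk
    by_contra! hkl
    have hstay : ∀ v, cycleTop π v = cycleTop π a → v < l → π v < l := by
      intro v hv hvl
      by_contra! hcon
      have hne : π v ≠ π k := π.injective.ne (by omega)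
      exact h0.not_231 hvl hlk (by omega) (by rw [hpl]; exact htop v hv hvl.ne)
    have := cycleTop_induction (P := fun v => v < l) (u := a) h hstay
    omega
  have hxl : l ≠ x := by
    rintro e
    have : a = x := by
      refine cycle_induction (P := fun v => v = x) rfl fun v _ hv => ?_
      rw [hv, ← e, hpl, e]
    omega
  have := cycle_induction (P := fun v => l < v) (u := a) (by omega) fun v hv hlv => hlow v hv hlv
  omega

theorem isNear_of_avoids_231 (h0 : Avoids π p231) (h1 : Avoids (theta π) p231)
    (h2 : Avoids (theta (theta π)) p231) : IsNear π := by
  refine isNear_of_cycleTop_le fun a ha => ?_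
  have hax := apply_eq_cycleTop_of_avoids_231 h0 ha
  by_contra! hlt
  set x := cycleTop π a with hx
  have hpx : π x < x := by
    refine lt_of_le_of_ne (by simpa [hx, cycleTop_cycleTop] using apply_le_cycleTop (π := π) x)
      fun h => ?_
    have := π.injective (h.trans hax.symm)
    omega
  have hs : StableBelow π (x.val + 1) := by
    intro u hu
    by_contra! hcon
    have hua : u ≠ a := by rintro rfl; omega
    have hux : u ≠ x := by rintro rfl; omega
    have hau := ha.apply_lt_iff u
    exact h0.not_231 (i := a) (j := u) (k := x) (by omega) (by omega) (by omega) (by omega)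
  have hw : theta π x = a := by
    rw [hs.theta_apply, ← hax, Equiv.symm_apply_apply]
  have htx : cycleTop (theta π) a = x := by
    apply le_antisymm
    · have := hs.theta.cycleTop_lt_iff a
      rw [Fin.le_def]; omega
    · rw [← hw, cycleTop_apply]; exact le_cycleTop x
  have hw' : theta π a = x := by rw [apply_eq_cycleTop_of_avoids_231 h1 ha.theta, htx]
  have htxx : cycleTop (theta π) x = x := by rw [← htx, cycleTop_cycleTop]
  let y : Fin n := ⟨a.val + 1, by omega⟩
  have hy : cycleTop (theta π) y < x := by
    refine lt_of_le_of_ne ?_ fun h => ?_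
    · have := hs.theta.cycleTop_lt_iff y
      change _ ↔ a.val + 1 < _ at this
      rw [Fin.le_def]; omega
    · have : y = x ∨ y = a :=
        cycle_induction (P := fun v => v = x ∨ v = a) (.inl h) fun v _ hv => by
          rcases hv with rfl | rfl
          · exact .inr hw
          · exact .inl hw'
      rcases this with h | h <;> have h := congrArg Fin.val h <;> simp only [y] at h <;> omega
  have hyx : Before (theta π) y x := before_of_cycleTop_lt (by rwa [htxx])
  have hxa : Before (theta π) x a := by
    have := before_apply_of_ne htxx (by rw [hw]; omega)
    rwa [hw] at this
  refine h2.not_231 (symm_theta_lt_iff.2 hyx) (symm_theta_lt_iff.2 hxa) ?_ ?_ <;>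
    simp only [Equiv.apply_symm_apply, Fin.lt_def, y] <;> omega

end Pattern231

section Pattern321

theorem apply_cycleTop_of_avoids_321 (h1 : Avoids (theta π) p321) {a : Fin n}
    (ha : StableBelow π a.val) : π (cycleTop π a) = a := by
  by_contra hne
  set x := cycleTop π a with hx
  have htx : cycleTop π x = x := cycleTop_cycleTop a
  have hle : a ≤ x := le_cycleTop a
  have hpx : a ≤ π x := by
    have := ha.apply_lt_iff x
    omega
  have hax : a ≠ x := by
    rintro e
    have := apply_le_cycleTop (π := π) x
    rw [htx] at this
    exact hne (by omega)
  have hxx : π x ≠ x := by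
    intro e
    refine hax (cycle_induction (P := fun v => v = x) (u := a) rfl fun v _ hv => ?_)
    rw [hv, e]
  have hpxx := apply_le_cycleTop (π := π) x
  rw [htx] at hpxx
  refine h1.not_321 (symm_theta_lt_iff.2 (before_apply_of_ne htx hxx))
    (symm_theta_lt_iff.2 (before_of_ne_of_ne htx hx.symm hax (Ne.symm hne))) ?_ ?_ <;>
    simp only [Equiv.apply_symm_apply] <;> omega

theorem isNear_of_avoids_321 (h0 : Avoids π p321) (h1 : Avoids (theta π) p321)
    (h2 : Avoids (theta (theta π)) p321) : IsNear π := by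
  refine isNear_of_cycleTop_le fun a ha => ?_
  have hxa := apply_cycleTop_of_avoids_321 h1 ha
  have hya := apply_cycleTop_of_avoids_321 h2 ha.theta
  have hwa := apply_le_cycleTop (π := theta π) a
  by_contra! hlt
  set x := cycleTop π a with hx
  set y := cycleTop (theta π) a with hy
  have htx : cycleTop π x = x := cycleTop_cycleTop a
  have htop : ∀ u, a ≤ u → x ≤ cycleTop π u := by
    intro u hu
    by_contra! hc
    set c := cycleTop π u with hcu
    have htc : cycleTop π c = c := cycleTop_cycleTop u
    have huc : u ≤ c := le_cycleTop u
    have hpc : π c ≤ c := by simpa [htc] using apply_le_cycleTop (π := π) c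
    have hpca : π c ≠ a := fun e => hc.ne (π.injective (e.trans hxa.symm))
    have hac := ha.apply_lt_iff c
    by_cases hfix : π c = c
    · have hex : ∃ v, v < c ∧ c < π v := by
        by_contra! hcon
        have := cycleTop_induction (P := fun v => v < c) (u := a) (by omega) fun v _ hv =>
          lt_of_le_of_ne (hcon v hv) fun e => hv.ne (π.injective (e.trans hfix.symm))
        omega
      obtain ⟨v, hv, hpv⟩ := hex
      exact h0.not_321 hv hc (by omega) (by omega)
    · refine h1.not_321 (symm_theta_lt_iff.2 (before_apply_of_ne htc hfix))
        ((symm_theta_lt_iff (v := a)).2 (before_of_cycleTop_lt ?_)) ?_ ?_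
      · rwa [cycleTop_apply, htc]
      all_goals simp only [Equiv.apply_symm_apply]; omega
  have hIx : cycleIdx π x = 0 := (show IsCycleTop π x from isCycleTop_cycleTop π a).cycleIdx_eq
  have hIa : cycleIdx π a ≤ 1 := by
    have hc : IsCycleTop π x := isCycleTop_cycleTop π a
    by_cases h1 : 1 < minimalPeriod π x
    · have := hc.cycleIdx_iterate h1
      rw [iterate_one, hxa] at this
      omega
    · have := cycleIdx_lt π a
      rw [← hx] at this
      omega
  have hfirst : ∀ u, Before π u a → a ≤ u → u = x := by
    intro u hu hau
    have h3 := htop u hau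
    rcases hu with hu | ⟨hu, hu'⟩
    · omega
    · have := cycleIdx_eq_zero (π := π) (u := u) (by omega)
      rw [this, hu]
  have hwx : theta π a = x := by
    have h3 := ha.theta.apply_lt_iff a
    have h4 := ha.theta.symm_apply_lt_iff x
    by_contra hne
    have h5 : Before π (theta π a) x := by
      rw [← symm_theta_lt_iff, Equiv.symm_apply_apply]
      refine lt_of_le_of_ne (by rw [Fin.le_def]; omega) fun e => hne ?_
      rw [e, Equiv.apply_symm_apply]
    have h6 := htop (theta π a) (by omega)
    rcases h5 with h5 | ⟨-, h5⟩ <;> omega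
  have hsucc : (theta π).symm a = y := by rw [← hya, Equiv.symm_apply_apply]
  let s : Fin n := ⟨a.val + 1, by omega⟩
  have hs : s < y := by rw [Fin.lt_def]; change a.val + 1 < _; omega
  have hsb := before_theta π hs
  rw [hya] at hsb
  have h7 := ha.theta.apply_lt_iff s
  change _ ↔ a.val + 1 < _ at h7
  have h8 := (theta π).injective ((hfirst _ hsb (by omega)).trans hwx.symm)
  have h9 := congrArg Fin.val h8
  simp [s] at h9

end Pattern321

end Patterns

section Counting

/-- The products of disjoint adjacent transpositions of `ℕ` that fix every `i ≥ n`. -/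
def nearNat (n : ℕ) : Set (Equiv.Perm ℕ) :=
  {π | (∀ i, ¬ i < n → π i = i) ∧ (∀ i, π (π i) = i) ∧ ∀ i, π i ≤ i + 1}

theorem nearNat_zero : nearNat 0 = {1} := by
  ext π
  simp only [nearNat, Set.mem_ofPred_eq, Set.mem_singleton_iff]
  constructor
  · exact fun h => Equiv.ext fun i => h.1 i (by omega)
  · rintro rfl
    simp

theorem nearNat_one : nearNat 1 = {1} := by
  ext π
  simp only [nearNat, Set.mem_ofPred_eq, Set.mem_singleton_iff]
  constructor
  · rintro ⟨h, -, -⟩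
    refine Equiv.ext fun i => ?_
    by_cases hi : i < 1
    · obtain rfl : i = 0 := by omega
      by_contra hne
      exact hne (π.injective (h (π 0) (by simp at hne; omega)))
    · exact h i hi
  · rintro rfl
    simp

theorem nearNat_add_two (n : ℕ) :
    nearNat (n + 2) = nearNat (n + 1) ∪ (· * Equiv.swap n (n + 1)) '' nearNat n := by
  ext π
  simp only [nearNat, Set.mem_union, Set.mem_image, Set.mem_ofPred_eq]
  constructor
  · rintro ⟨h1, h2, h3⟩
    by_cases hfix : π (n + 1) = n + 1
    · refine .inl ⟨fun i hi => ?_, h2, h3⟩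
      by_cases hi' : i = n + 1
      · rw [hi', hfix]
      · exact h1 i (by omega)
    · have h4 : π (n + 1) = n := by
        have h5 := h3 (π (n + 1))
        rw [h2] at h5
        have h6 : π (n + 1) < n + 2 := by
          by_contra h
          exact h (by have := h1 _ h; rw [h2] at this; omega)
        omega
      have h5 : π n = n + 1 := by rw [← h4, h2, h4]
      refine .inr ⟨π * Equiv.swap n (n + 1), ⟨?_, ?_, ?_⟩, by simp [mul_assoc]⟩
      all_goals
        intro i
        rcases eq_or_ne i n with rfl | hn
        · simp [h4]
        rcases eq_or_ne i (n + 1) with rfl | hn'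
        · simp [h5]
        have hs := Equiv.swap_apply_of_ne_of_ne hn hn'
        simp only [Equiv.Perm.mul_apply, hs]
      · exact fun hi => h1 i (by omega)
      · have h6 : π i ≠ n := fun e => hn' (π.injective (e.trans h4.symm))
        have h7 : π i ≠ n + 1 := fun e => hn (π.injective (e.trans h5.symm))
        rw [Equiv.swap_apply_of_ne_of_ne h6 h7, h2]
      · exact h3 i
  · rintro (⟨h1, h2, h3⟩ | ⟨τ, ⟨h1, h2, h3⟩, rfl⟩)
    · exact ⟨fun i hi => h1 i (by omega), h2, h3⟩
    · have h4 := h1 n (by omega)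
      have h5 := h1 (n + 1) (by omega)
      refine ⟨?_, ?_, ?_⟩
      all_goals
        intro i
        rcases eq_or_ne i n with rfl | hn
        · simp [h4, h5]
        rcases eq_or_ne i (n + 1) with rfl | hn'
        · simp [h4, h5] <;> omega
        have hs := Equiv.swap_apply_of_ne_of_ne hn hn'
        simp only [Equiv.Perm.mul_apply, hs]
      · exact fun hi => h1 i (by omega)
      · have h6 : τ i ≠ n := fun e => hn (τ.injective (e.trans h4.symm))
        have h7 : τ i ≠ n + 1 := fun e => hn' (τ.injective (e.trans h5.symm))
        rw [Equiv.swap_apply_of_ne_of_ne h6 h7, h2]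
      · exact h3 i

theorem finite_ncard_nearNat (n : ℕ) :
    ((nearNat n).Finite ∧ (nearNat n).ncard = Nat.fib (n + 1)) ∧
      (nearNat (n + 1)).Finite ∧ (nearNat (n + 1)).ncard = Nat.fib (n + 2) := by
  induction n with
  | zero => simp [nearNat_zero, nearNat_one]
  | succ n ih =>
    obtain ⟨⟨hf, hc⟩, hf', hc'⟩ := ih
    refine ⟨⟨hf', hc'⟩, ?_, ?_⟩
    · rw [nearNat_add_two]
      exact hf'.union (hf.image _)
    · rw [nearNat_add_two, Set.ncard_union_eq ?_ hf' (hf.image _),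
        Set.ncard_image_of_injective _ (mul_left_injective _), hc, hc', Nat.fib_add_two (n := n + 1),
        add_comm]
      rw [Set.disjoint_left]
      rintro _ ⟨h, -, -⟩ ⟨τ, ⟨h', -, -⟩, rfl⟩
      have := h (n + 1) (by omega)
      simp [h' n] at this

theorem card_isNear (n : ℕ) :
    Nat.card {π : Equiv.Perm (Fin n) // IsNear π} = Nat.fib (n + 1) := by
  let e : Equiv.Perm (Fin n) ≃ {f : Equiv.Perm ℕ // ∀ i, ¬ i < n → f i = i} :=
    (Fin.equivSubtype (n := n)).permCongr.trans
      (Equiv.Perm.subtypeEquivSubtypePerm fun i => i < n)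
  have he : ∀ (π : Equiv.Perm (Fin n)) (u : Fin n), (e π).1 u.val = (π u).val := by
    intro π u
    exact Equiv.Perm.subtypeEquivSubtypePerm_apply_of_mem (p := fun i => i < n)
      ((Fin.equivSubtype (n := n)).permCongr π) u.2
  have hnear : ∀ π : Equiv.Perm (Fin n), IsNear π ↔
      ((∀ i, (e π).1 ((e π).1 i) = i) ∧ ∀ i, (e π).1 i ≤ i + 1) := by
    intro π
    constructor
    · rintro ⟨h1, h2⟩
      refine ⟨fun i => ?_, fun i => ?_⟩ <;> by_cases hi : i < n
      · have := congrArg Fin.val (h1 ⟨i, hi⟩)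
        rwa [← he, ← he] at this
      · rw [(e π).2 i hi, (e π).2 i hi]
      · have := h2 ⟨i, hi⟩
        rwa [← he] at this
      · rw [(e π).2 i hi]; omega
    · rintro ⟨h1, h2⟩
      refine ⟨fun u => Fin.ext ?_, fun u => ?_⟩
      · rw [← he, ← he, h1]
      · rw [← he]; exact h2 _
  rw [← (finite_ncard_nearNat n).1.2, ← Nat.card_coe_set_eq]
  refine Nat.card_congr ((e.subtypeEquiv (p := IsNear)
    (q := fun f => (∀ i, f.1 (f.1 i) = i) ∧ ∀ i, f.1 i ≤ i + 1) hnear).trans ?_)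
  exact Equiv.subtypeSubtypeEquivSubtypeInter _
    fun f : Equiv.Perm ℕ => (∀ i, f (f i) = i) ∧ ∀ i, f i ≤ i + 1

end Counting

/-- for `n ≥ 1`, `k ≥ 2` and `σ ∈ {231, 312, 321}`,
`t_n^k(σ) = F_{n+1}`. -/
theorem tk_n_fib (n k : ℕ) (hn : 1 ≤ n) (hk : 2 ≤ k) (σ : Equiv.Perm (Fin 3))
    (hσ : σ = p231 ∨ σ = p312 ∨ σ = p321) :
    Nat.card {π : Equiv.Perm (Fin n) // ∀ i ≤ k, Avoids (theta^[i] π) σ} =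
      Nat.fib (n + 1) := by
  have key : ∀ π : Equiv.Perm (Fin n), (∀ i ≤ k, Avoids (theta^[i] π) σ) ↔ IsNear π := by
    intro π
    constructor
    · intro h
      have h0 : Avoids π σ := h 0 (by omega)
      have h1 : Avoids (theta π) σ := h 1 (by omega)
      have h2 : Avoids (theta (theta π)) σ := h 2 hk
      rcases hσ with rfl | rfl | rfl
      · exact isNear_of_avoids_231 h0 h1 h2
      · exact isNear_of_avoids_312 h0 h1 h2
      · exact isNear_of_avoids_321 h0 h1 h2
    · intro h i _
      rw [iterate_fixed h.theta_eq]
      exact h.avoids hσ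
  rw [← card_isNear n]
  exact Nat.card_congr (Equiv.subtypeEquivRight key)
end

section
/- Let n ≥ 3 and let π ∈ S_n satisfy θ²(π) = π and π_n ≠ n. Then: (i) for every index j with 1 ≤ j ≤ n−1, if π_j = n then π_{j+1} = j; and (ii) if π_n = r then π_{n−1} = r + 1. -/
open Function in
theorem mem_fundWord_s17 {n : ℕ} (σ : Equiv.Perm (Fin n)) (y : Fin n) : y ∈ fundWord σ := by
  have hy : Set.Nonempty {x | σ.SameCycle y x} := ⟨y, .refl ..⟩
  obtain ⟨x, hx, hmax⟩ := Set.exists_max_image _ id (Set.toFinite _) hy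
  have hper : x ∈ periodicPts σ := σ.injective.mem_periodicPts x
  obtain ⟨k, rfl⟩ := (Equiv.Perm.SameCycle.symm hx).exists_nat_pow_eq
  simp only [fundWord, List.mem_flatMap, List.mem_filter, List.mem_finRange, true_and,
    List.all_eq_true, List.mem_range, decide_eq_true_eq, List.mem_map]
  refine ⟨x, fun j _ => hmax _ (hx.trans ⟨j, ?_⟩), k % minimalPeriod σ x,
    Nat.mod_lt _ (minimalPeriod_pos_of_mem_periodicPts hper), ?_⟩
  · rw [zpow_natCast, Equiv.Perm.iterate_eq_pow]
  · rw [iterate_mod_minimalPeriod_eq, Equiv.Perm.iterate_eq_pow]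

open Function in
/-- Two largest elements of one cycle agree. -/
theorem eq_of_isMax_of_sameCycle {n : ℕ} {σ : Equiv.Perm (Fin n)} {x y : Fin n}
    (hx : ∀ k < n, σ^[k] x ≤ x) (hy : ∀ k < n, σ^[k] y ≤ y) (h : σ.SameCycle x y) : x = y := by
  have key : ∀ {x y : Fin n}, (∀ k < n, σ^[k] x ≤ x) → σ.SameCycle x y → y ≤ x := by
    intro x y hx h
    have hper : x ∈ periodicPts σ := σ.injective.mem_periodicPts x
    obtain ⟨k, rfl⟩ := h.exists_nat_pow_eq
    rw [← Equiv.Perm.iterate_eq_pow, ← iterate_mod_minimalPeriod_eq]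
    refine hx _ ((Nat.mod_lt _ (minimalPeriod_pos_of_mem_periodicPts hper)).trans_le ?_)
    simpa using minimalPeriod_le_card (f := σ) (x := x)
  exact le_antisymm (key hy h.symm) (key hx h)

open Function in
theorem nodup_fundWord {n : ℕ} (σ : Equiv.Perm (Fin n)) : (fundWord σ).Nodup := by
  rw [fundWord, List.nodup_flatMap]
  constructor
  · intro x _
    refine List.Nodup.map_on ?_ List.nodup_range
    intro a ha b hb hab
    exact iterate_injOn_Iio_minimalPeriod (List.mem_range.1 ha) (List.mem_range.1 hb) hab
  · refine ((List.nodup_finRange n).filter _).pairwise_of_forall_ne ?_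
    intro x hx y hy hxy z hzx hzy
    simp only [List.mem_filter, List.mem_finRange, true_and, List.all_eq_true, List.mem_range,
      decide_eq_true_eq, List.mem_map] at hx hy hzx hzy
    obtain ⟨a, -, rfl⟩ := hzx
    obtain ⟨b, -, hb⟩ := hzy
    refine hxy (eq_of_isMax_of_sameCycle hx hy ?_)
    rw [Equiv.Perm.iterate_eq_pow, Equiv.Perm.iterate_eq_pow] at hb
    rw [← Equiv.Perm.sameCycle_pow_left (n := a), ← hb, Equiv.Perm.sameCycle_pow_left]

theorem length_fundWord {n : ℕ} (σ : Equiv.Perm (Fin n)) : (fundWord σ).length = n := by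
  have h : (fundWord σ).Perm (List.finRange n) :=
    (List.perm_ext_iff_of_nodup (nodup_fundWord σ) (List.nodup_finRange n)).2
      fun y => by simp [mem_fundWord_s17]
  simpa using h.length_eq

theorem map_theta {n : ℕ} (σ : Equiv.Perm (Fin n)) :
    (List.finRange n).map (theta σ) = fundWord σ := by
  have hinj : Function.Injective fun i : Fin n =>
      (fundWord σ).get (i.cast (length_fundWord σ).symm) :=
    (List.nodup_iff_injective_get.1 (nodup_fundWord σ)).comp (Fin.cast_injective _)
  have hex : ∃ τ : Equiv.Perm (Fin n), (List.finRange n).map τ = fundWord σ := by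
    refine ⟨Equiv.ofBijective _ (Finite.injective_iff_bijective.1 hinj), ?_⟩
    apply List.ext_getElem
    · simp [length_fundWord]
    · simp
  exact Function.invFun_eq hex

/-- The one-line word of `theta σ` ends with the cycle of the largest element, starting at
that element. -/
theorem theta_last_cycle {n : ℕ} (σ : Equiv.Perm (Fin (n + 1))) :
    ∃ m p : ℕ, 0 < p ∧ m + p = n + 1 ∧ σ^[p] (Fin.last n) = Fin.last n ∧
      ∀ k (hk : m + k < n + 1), theta σ ⟨m + k, hk⟩ = σ^[k] (Fin.last n) := by
  obtain ⟨pre, hpre⟩ : ∃ pre, fundWord σ = pre ++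
      (List.range (Function.minimalPeriod σ (Fin.last n))).map fun k => σ^[k] (Fin.last n) := by
    simp [fundWord, List.finRange_succ_last, List.filter_append, Fin.le_last]
  have hlen := length_fundWord σ
  rw [hpre, List.length_append, List.length_map, List.length_range] at hlen
  refine ⟨pre.length, _, Function.minimalPeriod_pos_of_mem_periodicPts
    (σ.injective.mem_periodicPts _), hlen, Function.isPeriodicPt_minimalPeriod _ _, ?_⟩
  intro k hk
  have h := congrArg (·[pre.length + k]?) ((map_theta σ).trans hpre)
  have hk' : k < Function.minimalPeriod σ (Fin.last n) := by omega
  simpa [hk, hk'] using h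

theorem apply_theta_last {n : ℕ} (σ : Equiv.Perm (Fin (n + 1))) :
    σ (theta σ (Fin.last n)) = Fin.last n := by
  obtain ⟨m, p, hp, hmp, hper, h⟩ := theta_last_cycle σ
  have h1 : Fin.last n = ⟨m + (p - 1), by omega⟩ := Fin.ext (by simp; omega)
  conv_lhs => rw [h1, h, ← Function.iterate_succ_apply' σ]
  rwa [Nat.succ_eq_add_one, Nat.sub_add_cancel hp]

theorem theta_succ_of_theta_eq_last {n : ℕ} (σ : Equiv.Perm (Fin (n + 1))) {i : ℕ}
    (hi : i + 1 < n + 1) (h : theta σ ⟨i, by omega⟩ = Fin.last n) :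
    theta σ ⟨i + 1, hi⟩ = σ (Fin.last n) := by
  obtain ⟨m, p, hp, hmp, hper, hm⟩ := theta_last_cycle σ
  have him : i = m := by
    simpa using (theta σ).injective (h.trans (hm 0 (by omega)).symm)
  subst him
  exact hm 1 hi

theorem apply_theta_pred_last {n : ℕ} (σ : Equiv.Perm (Fin (n + 1)))
    (h : theta σ (Fin.last n) ≠ Fin.last n) :
    σ (theta σ ⟨n - 1, by omega⟩) = theta σ (Fin.last n) := by
  obtain ⟨m, p, hp, hmp, hper, hm⟩ := theta_last_cycle σ
  have hmn : m ≠ n := by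
    rintro rfl
    exact h (hm 0 (by omega))
  have h1 : Fin.last n = ⟨m + (n - 1 - m + 1), by omega⟩ := Fin.ext (by simp; omega)
  have h2 : (⟨n - 1, by omega⟩ : Fin (n + 1)) = ⟨m + (n - 1 - m), by omega⟩ :=
    Fin.ext (by simp; omega)
  conv_rhs => rw [h1, hm]
  rw [h2, hm, Function.iterate_succ_apply']

/-- if `θ²(π) = π` and `π_n ≠ n` (one-indexed), then (i) `π_j = n`
implies `π_{j+1} = j` for `1 ≤ j ≤ n−1`, and (ii) `π_n = r` implies `π_{n−1} = r+1`.
(Here positions and values are zero-indexed: position/value `j−1` encodes `j`.) -/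
theorem order_two_structure (n : ℕ) (hn : 3 ≤ n) (π : Equiv.Perm (Fin n))
    (hfix : theta (theta π) = π)
    (hlast : π ⟨n - 1, by omega⟩ ≠ ⟨n - 1, by omega⟩) :
    (∀ j : Fin n, (hj : (j : ℕ) + 1 ≤ n - 1) → π j = ⟨n - 1, by omega⟩ →
        π ⟨(j : ℕ) + 1, by omega⟩ = j) ∧
    ((π ⟨n - 2, by omega⟩ : ℕ) = (π ⟨n - 1, by omega⟩ : ℕ) + 1) := by
  obtain ⟨n, rfl⟩ : ∃ k, n = k + 1 := ⟨n - 1, by omega⟩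
  change π (Fin.last n) ≠ Fin.last n at hlast
  have hπ : π (theta π (Fin.last n)) = Fin.last n := apply_theta_last π
  have hσ : theta π (π (Fin.last n)) = Fin.last n := by
    simpa only [hfix] using apply_theta_last (theta π)
  refine ⟨fun j hj hjn => ?_, ?_⟩
  · have h := theta_succ_of_theta_eq_last (theta π) (i := j) (by omega) (by rw [hfix]; exact hjn)
    rw [hfix] at h
    exact h.trans (π.injective (hπ.trans hjn.symm))
  · have hr : (π (Fin.last n) : ℕ) < n := Fin.val_lt_last hlast
    have h := theta_succ_of_theta_eq_last π (i := π (Fin.last n)) (by omega) hσ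
    have h' := apply_theta_pred_last (theta π) (by rwa [hfix])
    rw [hfix] at h'
    exact congrArg Fin.val ((theta π).injective (h'.trans h.symm))
end
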